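/- arXiv:2409.00624 — 2 statements merged into one kernel-verified Lean document; each statement's English description precedes it below -/
import Mathlib

section
/- Let S_n denote the number of subsets S of {1,…,n} such that no two elements of S differ by 1 or by 5 (i.e., with disallowed-differences set Q = {1,5}), with S_0 = 1. Then in the ring of formal power series ℤ[[x]], (∑_{n≥0} S_n x^n)·(1 − x^2 − x^3 − x^4 + x^5 − x^6 − x^7 − x^8 − x^{10}) = 1 + 2x + 2x^2 + 2x^3 + 2x^4 + 4x^5 + 3x^6 + 2x^7 + x^8 + x^9. -/
/-- `restrictedCount Q n` is the number of subsets of `{1,…,n}` in which no two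
elements differ by an element of `Q`. -/
def restrictedCount (Q : Finset ℕ) (n : ℕ) : ℕ :=
  ((Finset.Icc 1 n).powerset.filter
    fun s => ∀ a ∈ s, ∀ b ∈ s, b < a → a - b ∉ Q).card

/-- The number of subsets of `{1,…,n}` in which no two elements differ by an element of `Q` and
no element lies at a distance from `n` belonging to `B`. -/
def restrictedAvoidingCount (Q B : Finset ℕ) (n : ℕ) : ℕ :=
  ((Finset.Icc 1 n).powerset.filter
    fun s => (∀ a ∈ s, ∀ b ∈ s, b < a → a - b ∉ Q) ∧ ∀ a ∈ s, n - a ∉ B).card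

theorem restrictedAvoidingCount_empty (Q : Finset ℕ) (n : ℕ) :
    restrictedAvoidingCount Q ∅ n = restrictedCount Q n := by
  simp [restrictedAvoidingCount, restrictedCount]

theorem restrictedAvoidingCount_zero (Q B : Finset ℕ) : restrictedAvoidingCount Q B 0 = 1 := by
  simp [restrictedAvoidingCount, Finset.filter_singleton]

theorem restrictedAvoidingCount_succ_eq_sum (Q B : Finset ℕ) (n : ℕ) :
    restrictedAvoidingCount Q B (n + 1) =
      (∑ s ∈ (Finset.Icc 1 n).powerset,
        if (∀ a ∈ s, ∀ b ∈ s, b < a → a - b ∉ Q) ∧ ∀ a ∈ s, n + 1 - a ∉ B then 1 else 0) +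
      ∑ s ∈ (Finset.Icc 1 n).powerset,
        if (∀ a ∈ insert (n + 1) s, ∀ b ∈ insert (n + 1) s, b < a → a - b ∉ Q) ∧
          ∀ a ∈ insert (n + 1) s, n + 1 - a ∉ B then 1 else 0 := by
  rw [restrictedAvoidingCount, Finset.card_filter,
    ← Finset.insert_Icc_right_eq_Icc_add_one (by lia), Finset.sum_powerset_insert (by simp)]

theorem sum_shift_eq_restrictedAvoidingCount {Q B C : Finset ℕ} (hC : ∀ i, i ∈ C ↔ i + 1 ∈ B)
    (n : ℕ) :
    (∑ s ∈ (Finset.Icc 1 n).powerset,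
      if (∀ a ∈ s, ∀ b ∈ s, b < a → a - b ∉ Q) ∧ ∀ a ∈ s, n + 1 - a ∉ B then 1 else 0) =
      restrictedAvoidingCount Q C n := by
  rw [restrictedAvoidingCount, Finset.card_filter]
  refine Finset.sum_congr rfl fun s hs => if_congr (and_congr_right fun _ => ?_) rfl rfl
  refine forall₂_congr fun a ha => ?_
  have ha' := Finset.mem_Icc.1 (Finset.mem_powerset.1 hs ha)
  rw [hC, Nat.sub_add_comm ha'.2]

/-- If `n + 1` is excluded, only the distances shift. -/
theorem restrictedAvoidingCount_succ_of_mem {Q B C : Finset ℕ} (h : 0 ∈ B)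
    (hC : ∀ i, i ∈ C ↔ i + 1 ∈ B) (n : ℕ) :
    restrictedAvoidingCount Q B (n + 1) = restrictedAvoidingCount Q C n := by
  rw [restrictedAvoidingCount_succ_eq_sum, sum_shift_eq_restrictedAvoidingCount hC,
    add_eq_left]
  refine Finset.sum_eq_zero fun s _ => if_neg fun hs => ?_
  exact hs.2 (n + 1) (Finset.mem_insert_self _ _) (by simpa using h)

/-- If `n + 1` is allowed, choosing it excludes the distances in `Q` from it. -/
theorem restrictedAvoidingCount_succ_of_notMem {Q B C D : Finset ℕ} (h : 0 ∉ B)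
    (hC : ∀ i, i ∈ C ↔ i + 1 ∈ B) (hD : ∀ i, i ∈ D ↔ i + 1 ∈ B ∨ i + 1 ∈ Q) (n : ℕ) :
    restrictedAvoidingCount Q B (n + 1) =
      restrictedAvoidingCount Q C n + restrictedAvoidingCount Q D n := by
  rw [restrictedAvoidingCount_succ_eq_sum, sum_shift_eq_restrictedAvoidingCount hC,
    restrictedAvoidingCount.eq_def Q D, Finset.card_filter]
  congr 1
  refine Finset.sum_congr rfl fun s hs => if_congr ?_ rfl rfl
  have hle : ∀ a ∈ s, a ≤ n := fun a ha =>
    (Finset.mem_Icc.1 (Finset.mem_powerset.1 hs ha)).2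
  have hD' : ∀ a ∈ s, (n - a ∈ D ↔ n + 1 - a ∈ B ∨ n + 1 - a ∈ Q) := fun a ha => by
    rw [hD, Nat.sub_add_comm (hle a ha)]
  simp only [Finset.forall_mem_insert, lt_irrefl, Nat.sub_self]
  constructor
  · rintro ⟨⟨⟨-, h₁⟩, h₂⟩, -, h₃⟩
    refine ⟨fun a ha => (h₂ a ha).2, fun a ha hmem => ?_⟩
    exact ((hD' a ha).1 hmem).elim (h₃ a ha) (h₁ a ha (Nat.lt_succ_of_le (hle a ha)))
  · rintro ⟨h₁, h₂⟩
    refine ⟨⟨⟨fun h => h.elim, fun b hb _ hmem => h₂ b hb ((hD' b hb).2 (.inr hmem))⟩,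
      fun a ha => ⟨fun hlt => ?_, h₁ a ha⟩⟩, h,
      fun a ha hmem => h₂ a ha ((hD' a ha).2 (.inl hmem))⟩
    exact absurd hlt (by have := hle a ha; lia)

section OneFive

local notation "N" => restrictedAvoidingCount {1, 5}

theorem restrictedAvoidingCount_one_five_succ (n : ℕ) :
    N ∅ (n + 1) = N ∅ n + N {0, 4} n ∧
    N {0, 4} (n + 1) = N {3} n ∧
    N {3} (n + 1) = N {2} n + N {0, 2, 4} n ∧
    N {2} (n + 1) = N {1} n + N {0, 1, 4} n ∧
    N {0, 2, 4} (n + 1) = N {1, 3} n ∧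
    N {1} (n + 1) = N {0} n + N {0, 4} n ∧
    N {0, 1, 4} (n + 1) = N {0, 3} n ∧
    N {1, 3} (n + 1) = N {0, 2} n + N {0, 2, 4} n ∧
    N {0} (n + 1) = N ∅ n ∧
    N {0, 3} (n + 1) = N {2} n ∧
    N {0, 2} (n + 1) = N {1} n := by
  refine ⟨?_, ?_, ?_, ?_, ?_, ?_, ?_, ?_, ?_, ?_, ?_⟩ <;>
  first
  | exact restrictedAvoidingCount_succ_of_mem (by simp) (by simp) n
  | exact restrictedAvoidingCount_succ_of_notMem (by simp) (by simp)
      (by intro i; simp; try lia) n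

theorem restrictedAvoidingCount_one_five_add_ten (n : ℕ) :
    N ∅ (n + 10) + N ∅ (n + 5) =
      N ∅ (n + 8) + N ∅ (n + 7) + N ∅ (n + 6) + N ∅ (n + 4) + N ∅ (n + 3) + N ∅ (n + 2) +
        N ∅ n := by
  simp only [restrictedAvoidingCount_one_five_succ]
  lia

theorem restrictedAvoidingCount_one_five_of_lt_ten :
    N ∅ 0 = 1 ∧ N ∅ 1 = 2 ∧ N ∅ 2 = 3 ∧ N ∅ 3 = 5 ∧ N ∅ 4 = 8 ∧ N ∅ 5 = 13 ∧ N ∅ 6 = 18 ∧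
      N ∅ 7 = 28 ∧ N ∅ 8 = 41 ∧ N ∅ 9 = 62 := by
  have h (B : Finset ℕ) : N B 0 = 1 := restrictedAvoidingCount_zero _ B
  simp [restrictedAvoidingCount_one_five_succ, h]

end OneFive

/-- generating function for `S^{{1,5}}_n`. -/
theorem stmt_4 :
    (PowerSeries.mk fun n => (restrictedCount {1, 5} n : ℤ)) *
        (1 - PowerSeries.X ^ 2 - PowerSeries.X ^ 3 - PowerSeries.X ^ 4 +
          PowerSeries.X ^ 5 - PowerSeries.X ^ 6 - PowerSeries.X ^ 7 -
          PowerSeries.X ^ 8 - PowerSeries.X ^ 10) =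
      1 + 2 * PowerSeries.X + 2 * PowerSeries.X ^ 2 + 2 * PowerSeries.X ^ 3 +
        2 * PowerSeries.X ^ 4 + 4 * PowerSeries.X ^ 5 + 3 * PowerSeries.X ^ 6 +
        2 * PowerSeries.X ^ 7 + PowerSeries.X ^ 8 + PowerSeries.X ^ 9 := by
  simp only [← restrictedAvoidingCount_empty]
  have two : (2 : PowerSeries ℤ) = PowerSeries.C 2 := by simp
  have three : (3 : PowerSeries ℤ) = PowerSeries.C 3 := by simp
  have four : (4 : PowerSeries ℤ) = PowerSeries.C 4 := by simp
  ext n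
  simp only [two, three, four, map_add, PowerSeries.coeff_C_mul, PowerSeries.coeff_X_pow,
    PowerSeries.coeff_X, PowerSeries.coeff_one]
  simp only [mul_add, mul_sub, mul_one, map_add, map_sub, PowerSeries.coeff_mul_X_pow',
    PowerSeries.coeff_mk]
  obtain hn | hn := lt_or_ge n 10
  · obtain ⟨h0, h1, h2, h3, h4, h5, h6, h7, h8, h9⟩ := restrictedAvoidingCount_one_five_of_lt_ten
    interval_cases n <;> simp [h0, h1, h2, h3, h4, h5, h6, h7, h8, h9]
  · obtain ⟨m, rfl⟩ := Nat.exists_eq_add_of_le' hn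
    have h := restrictedAvoidingCount_one_five_add_ten m
    have hlt (k : ℕ) (hk : k < 10) : (m + 10 = k) = False := eq_false (by lia)
    have hle (k : ℕ) (hk : k ≤ 10) : (k ≤ m + 10) = True := eq_true (by lia)
    simp only [hlt, hle, Nat.reduceLT, Nat.reduceLeDiff, Nat.ofNat_pos, Nat.one_lt_ofNat,
      Nat.reduceSubDiff, Nat.add_sub_cancel, if_true, if_false]
    lia
end

section
/- Let m ≥ 1, j ≥ 1, i ≥ 0, 0 ≤ r ≤ m−1 and k ≥ 0 be integers. The number of permutations π of {1,…,im+r} satisfying π(s) − s ∈ {−m, 0, jm} for all s and having exactly k excedances equals the coefficient of x^k in the polynomial (f^{(j+1)}_i(x))^{m−r} · (f^{(j+1)}_{i+1}(x))^r. -/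
/-- The `(1,t)`-bonacci polynomials `f^{(t)}_n(x)`, satisfying
`f^{(t)}_n(x) = f^{(t)}_{n-1}(x) + x·f^{(t)}_{n-t}(x) + δ_{n,0}` with
`f^{(t)}_{n<0}(x) = 0` (for `t ≥ 1`). -/
noncomputable def bonacciPoly (t : ℕ) : ℕ → Polynomial ℕ
  | 0 => 1
  | n + 1 =>
    bonacciPoly t n +
      if h : 0 < t ∧ t ≤ n + 1 then Polynomial.X * bonacciPoly t (n + 1 - t) else 0
  termination_by n => n
  decreasing_by all_goals omega

open Equiv

/-- The permutations of `ι × ℕ` that preserve every column, are supported in column `c` on the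
`ℓ c` points starting at height `b c`, and move each point by `-1`, `0` or `j`. -/
def IsBanded {ι : Type*} (j : ℕ) (b ℓ : ι → ℕ) (π : Perm (ι × ℕ)) : Prop :=
  (∀ x, ¬ (b x.1 ≤ x.2 ∧ x.2 < b x.1 + ℓ x.1) → π x = x) ∧
    ∀ x, (π x).1 = x.1 ∧ ((π x).2 + 1 = x.2 ∨ (π x).2 = x.2 ∨ (π x).2 = x.2 + j)

/-- The points raised by a permutation of `ι × ℕ`. -/
def excSet {ι : Type*} (π : Perm (ι × ℕ)) : Set (ι × ℕ) := {x | x.2 < (π x).2}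

/-- The cycle `(c, a) ↦ (c, a + j) ↦ (c, a + j - 1) ↦ ⋯ ↦ (c, a)`. -/
def columnCycle {ι : Type*} [DecidableEq ι] (c : ι) (a j : ℕ) : Perm (ι × ℕ) where
  toFun x := if x.1 = c ∧ a ≤ x.2 ∧ x.2 ≤ a + j then
    (if x.2 = a then (c, a + j) else (c, x.2 - 1)) else x
  invFun x := if x.1 = c ∧ a ≤ x.2 ∧ x.2 ≤ a + j then
    (if x.2 = a + j then (c, a) else (c, x.2 + 1)) else x
  left_inv := by
    rintro ⟨d, q⟩
    grind
  right_inv := by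
    rintro ⟨d, q⟩
    grind

section

variable {ι : Type*} {j : ℕ} {b ℓ : ι → ℕ} {π : Perm (ι × ℕ)}

lemma IsBanded.apply_mem (h : IsBanded j b ℓ π) {x : ι × ℕ} (hx : π x ≠ x) :
    b x.1 ≤ (π x).2 ∧ (π x).2 < b x.1 + ℓ x.1 := by
  by_contra hn
  rw [← (h.2 x).1] at hn
  exact hx (π.injective (h.1 _ hn))

lemma IsBanded.apply_eq (h : IsBanded j b ℓ π) (x : ι × ℕ) : π x = (x.1, (π x).2) :=
  Prod.ext (h.2 x).1 rfl

lemma IsBanded.descend (h : IsBanded j b ℓ π) {c : ι} {n : ℕ}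
    (hn : ℓ c = n + 1) (hp : π (c, b c + n) ≠ (c, b c + n)) (i : ℕ) (hi : i < j) :
    i + 1 ≤ n ∧ π (c, b c + n - i) = (c, b c + n - i - 1) := by
  have step : ∀ i < j, i ≤ n → π (c, b c + n - i) ≠ (c, b c + n - i) →
      i + 1 ≤ n ∧ π (c, b c + n - i) = (c, b c + n - i - 1) := by
    intro i hi hin hne
    have h1 := h.apply_mem hne
    have h2 := (h.2 (c, b c + n - i)).2
    have h3 := h.apply_eq (c, b c + n - i)
    have h4 : (π (c, b c + n - i)).2 ≠ b c + n - i := fun h5 => hne (by rw [h3, h5])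
    simp only [hn] at h1 h2
    refine ⟨by omega, h3.trans (Prod.ext rfl ?_)⟩
    simp only
    omega
  induction i with
  | zero => exact step 0 hi (Nat.zero_le _) hp
  | succ i ih =>
    obtain ⟨h1, h2⟩ := ih (by omega)
    refine step (i + 1) hi h1 fun h3 => ?_
    have h4 := π.injective (h2.trans (by rw [← Nat.sub_sub] at h3; exact h3.symm))
    simp only [Prod.mk.injEq, true_and] at h4
    omega

lemma IsBanded.top_block (hj : 1 ≤ j) (h : IsBanded j b ℓ π) {c : ι} {n : ℕ}
    (hn : ℓ c = n + 1) (hp : π (c, b c + n) ≠ (c, b c + n)) :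
    j ≤ n ∧ π (c, b c + (n - j)) = (c, b c + n) ∧
      ∀ q, b c + (n - j) < q → q ≤ b c + n → π (c, q) = (c, q - 1) := by
  have hjn : j ≤ n := by
    have := (h.descend hn hp (j - 1) (by omega)).1
    omega
  refine ⟨hjn, ?_, fun q h1 h2 => ?_⟩
  · obtain ⟨⟨d, q⟩, hx⟩ := π.surjective (c, b c + n)
    have h1 := h.2 (d, q)
    have h2 : π (d, q) ≠ (d, q) := by
      intro h3
      exact hp (by rw [← hx, h3, h3])
    have h3 : b d ≤ q ∧ q < b d + ℓ d := by
      by_contra h4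
      exact h2 (h.1 _ h4)
    rw [hx] at h1 h2
    obtain ⟨rfl, h1⟩ := h1
    have h4 : b c + n ≠ q := by
      rintro rfl
      exact h2 rfl
    simp only [hn] at h1 h3
    rw [← hx]
    congr 2
    omega
  · have := (h.descend hn hp (b c + n - q) (by omega)).2
    rwa [show b c + n - (b c + n - q) = q by omega] at this

variable [DecidableEq ι]

lemma isBanded_update_iff {c : ι} {n : ℕ} (hn : ℓ c = n + 1) :
    IsBanded j b (Function.update ℓ c n) π ↔
      IsBanded j b ℓ π ∧ π (c, b c + n) = (c, b c + n) := by
  constructor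
  · rintro ⟨h1, h2⟩
    refine ⟨⟨fun x hx => h1 x ?_, h2⟩, h1 _ (by simp)⟩
    grind [Function.update_apply]
  · rintro ⟨⟨h1, h2⟩, h3⟩
    refine ⟨fun x hx => ?_, h2⟩
    by_cases hx' : x = (c, b c + n)
    · rw [hx', h3]
    · apply h1
      obtain ⟨d, q⟩ := x
      grind [Function.update_apply]

lemma columnCycle_apply (c : ι) (a j : ℕ) (x : ι × ℕ) : columnCycle c a j x =
    if x.1 = c ∧ a ≤ x.2 ∧ x.2 ≤ a + j then
      (if x.2 = a then (c, a + j) else (c, x.2 - 1)) else x := rfl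

lemma columnCycle_symm_apply (c : ι) (a j : ℕ) (x : ι × ℕ) : (columnCycle c a j).symm x =
    if x.1 = c ∧ a ≤ x.2 ∧ x.2 ≤ a + j then
      (if x.2 = a + j then (c, a) else (c, x.2 + 1)) else x := rfl

lemma IsBanded.mul_columnCycle_apply {c : ι} {a : ℕ}
    (h : IsBanded j b (Function.update ℓ c a) π) (x : ι × ℕ) :
    (π * columnCycle c (b c + a) j) x =
      if x.1 = c ∧ b c + a ≤ x.2 then columnCycle c (b c + a) j x else π x := by
  have hfix : ∀ q, b c + a ≤ q → π (c, q) = (c, q) := fun q hq => h.1 _ (by simp [hq])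
  obtain ⟨d, q⟩ := x
  rw [Perm.mul_apply, columnCycle_apply]
  grind

lemma IsBanded.mul_columnCycle {c : ι} {a : ℕ} (hn : ℓ c = a + j + 1)
    (h : IsBanded j b (Function.update ℓ c a) π) :
    IsBanded j b ℓ (π * columnCycle c (b c + a) j) := by
  refine ⟨fun x hx => ?_, fun x => ?_⟩
  · rw [h.mul_columnCycle_apply]
    have := h.1 x
    obtain ⟨d, q⟩ := x
    grind [Function.update_apply, columnCycle_apply]
  · rw [h.mul_columnCycle_apply]
    have := h.2 x
    obtain ⟨d, q⟩ := x
    grind [columnCycle_apply]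

lemma IsBanded.excSet_mul_columnCycle (hj : 1 ≤ j) {c : ι} {a : ℕ}
    (h : IsBanded j b (Function.update ℓ c a) π) :
    excSet (π * columnCycle c (b c + a) j) = insert (c, b c + a) (excSet π) := by
  have hfix : ∀ q, b c + a ≤ q → π (c, q) = (c, q) := fun q hq => h.1 _ (by simp [hq])
  ext ⟨d, q⟩
  simp only [excSet, Set.mem_ofPred_eq, Set.mem_insert_iff, h.mul_columnCycle_apply,
    Prod.mk.injEq, columnCycle_apply]
  grind

lemma IsBanded.encard_excSet_mul_columnCycle (hj : 1 ≤ j) {c : ι} {a : ℕ}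
    (h : IsBanded j b (Function.update ℓ c a) π) :
    (excSet (π * columnCycle c (b c + a) j)).encard = (excSet π).encard + 1 := by
  rw [h.excSet_mul_columnCycle hj, Set.encard_insert_of_notMem]
  simp [excSet, h.1 (c, b c + a) (by simp)]

lemma IsBanded.mul_columnCycle_symm (hj : 1 ≤ j) {c : ι} {a : ℕ} (hn : ℓ c = a + j + 1)
    (h : IsBanded j b ℓ π) (hp : π (c, b c + (a + j)) ≠ (c, b c + (a + j))) :
    IsBanded j b (Function.update ℓ c a) (π * (columnCycle c (b c + a) j).symm) := by
  obtain ⟨-, h1, h2⟩ := h.top_block hj hn hp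
  rw [Nat.add_sub_cancel] at h1 h2
  have key : ∀ x : ι × ℕ, (π * (columnCycle c (b c + a) j).symm) x =
      if x.1 = c ∧ b c + a ≤ x.2 ∧ x.2 ≤ b c + a + j then x else π x := by
    rintro ⟨d, q⟩
    rw [Perm.mul_apply, columnCycle_symm_apply]
    dsimp only
    split_ifs with hb hq
    · rw [h1, hb.1, hq, Nat.add_assoc]
    · rw [h2 _ (by omega) (by omega), hb.1, Nat.add_sub_cancel]
    · rfl
  refine ⟨fun x hx => ?_, fun x => ?_⟩
  · rw [key]
    split_ifs with hb
    · rfl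
    · refine h.1 x fun hx' => ?_
      by_cases hc : x.1 = c
      · simp only [hc, Function.update_self, true_and] at hx hx' hb
        omega
      · rw [Function.update_of_ne hc] at hx
        exact hx hx'
  · rw [key]
    split_ifs
    · simp
    · exact h.2 x

lemma setOf_isBanded_top_moved (hj : 1 ≤ j) {c : ι} {a : ℕ} (hn : ℓ c = a + j + 1) (e : ℕ∞) :
    {π : Perm (ι × ℕ) | (IsBanded j b ℓ π ∧ π (c, b c + (a + j)) ≠ (c, b c + (a + j))) ∧
        (excSet π).encard = e} =
      (· * columnCycle c (b c + a) j) ''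
        {π | IsBanded j b (Function.update ℓ c a) π ∧ (excSet π).encard + 1 = e} := by
  ext π
  constructor
  · rintro ⟨⟨h1, h2⟩, h3⟩
    have h4 := h1.mul_columnCycle_symm hj hn h2
    have h5 : π * (columnCycle c (b c + a) j).symm * columnCycle c (b c + a) j = π :=
      inv_mul_cancel_right π _
    refine ⟨π * (columnCycle c (b c + a) j).symm, ⟨h4, ?_⟩, h5⟩
    rw [← h4.encard_excSet_mul_columnCycle hj, h5, h3]
  · rintro ⟨τ, ⟨h1, h2⟩, rfl⟩
    refine ⟨⟨h1.mul_columnCycle hn, ?_⟩, (h1.encard_excSet_mul_columnCycle hj).trans h2⟩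
    simp only [ne_eq, h1.mul_columnCycle_apply, columnCycle_apply]
    grind

lemma bonacciPoly_succ (j n : ℕ) : bonacciPoly (j + 1) (n + 1) = bonacciPoly (j + 1) n +
    if j ≤ n then Polynomial.X * bonacciPoly (j + 1) (n - j) else 0 := by
  rw [bonacciPoly]
  simp

theorem encard_isBanded [Fintype ι] (hj : 1 ≤ j) (b : ι → ℕ) (ℓ : ι → ℕ) (k : ℕ) :
    {π : Perm (ι × ℕ) | IsBanded j b ℓ π ∧ (excSet π).encard = k}.encard =
      ((∏ c, bonacciPoly (j + 1) (ℓ c)).coeff k : ℕ) := by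
  induction hN : ∑ c, ℓ c using Nat.strong_induction_on generalizing ℓ k with
  | _ N ih =>
  by_cases h0 : ∀ c, ℓ c = 0
  · have h1 : ∀ π : Perm (ι × ℕ), IsBanded j b ℓ π ↔ π = 1 := by
      intro π
      refine ⟨fun h => Equiv.ext fun x => h.1 x (by simp [h0]), ?_⟩
      rintro rfl
      simp [IsBanded]
    have h2 : excSet (1 : Perm (ι × ℕ)) = ∅ := by simp [excSet]
    simp only [h1, h0, bonacciPoly, Finset.prod_const_one, Polynomial.coeff_one]
    rcases Nat.eq_zero_or_pos k with rfl | hk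
    · have : {π : Perm (ι × ℕ) | π = 1 ∧ (excSet π).encard = (0 : ℕ)} = {1} := by
        ext π
        simp only [Set.mem_ofPred_eq, Set.mem_singleton_iff, and_iff_left_iff_imp]
        rintro rfl
        simp [h2]
      rw [this]
      simp
    · have : {π : Perm (ι × ℕ) | π = 1 ∧ (excSet π).encard = k} = ∅ := by
        ext π
        simp only [Set.mem_ofPred_eq, Set.mem_empty_iff_false, iff_false, not_and]
        rintro rfl
        rw [h2, Set.encard_empty]
        exact_mod_cast hk.ne
      rw [this]
      simp [hk.ne']
  push Not at h0
  obtain ⟨c, hc⟩ := h0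
  obtain ⟨n, hn⟩ := Nat.exists_eq_succ_of_ne_zero hc
  have hsum : ∀ a ≤ n, ∑ d, Function.update ℓ c a d < N := by
    intro a ha
    rw [← hN]
    refine Finset.sum_lt_sum (fun d _ => ?_) ⟨c, Finset.mem_univ c, ?_⟩
    · by_cases hd : d = c
      · subst hd
        simp
        omega
      · simp [hd]
    · simp
      omega
  have hprod : ∀ a, ∏ d, bonacciPoly (j + 1) (Function.update ℓ c a d) =
      bonacciPoly (j + 1) a * ∏ d ∈ Finset.univ.erase c, bonacciPoly (j + 1) (ℓ d) := by
    intro a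
    rw [← Finset.mul_prod_erase _ _ (Finset.mem_univ c), Function.update_self]
    congr 1
    refine Finset.prod_congr rfl fun d hd => ?_
    rw [Function.update_of_ne (Finset.ne_of_mem_erase hd)]
  have hsplit : {π : Perm (ι × ℕ) | IsBanded j b ℓ π ∧ (excSet π).encard = k} =
      {π | IsBanded j b (Function.update ℓ c n) π ∧ (excSet π).encard = k} ∪
      {π | (IsBanded j b ℓ π ∧ π (c, b c + n) ≠ (c, b c + n)) ∧ (excSet π).encard = k} := by
    ext π
    simp only [Set.mem_union, Set.mem_ofPred_eq, isBanded_update_iff hn]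
    tauto
  have hdisj : Disjoint
      {π | IsBanded j b (Function.update ℓ c n) π ∧ (excSet π).encard = k}
      {π | (IsBanded j b ℓ π ∧ π (c, b c + n) ≠ (c, b c + n)) ∧ (excSet π).encard = k} := by
    rw [Set.disjoint_left]
    rintro π ⟨h1, -⟩ ⟨⟨-, h2⟩, -⟩
    exact h2 ((isBanded_update_iff hn).1 h1).2
  rw [hsplit, Set.encard_union_eq hdisj, ih _ (hsum n le_rfl) _ _ rfl, hprod,
    ← Finset.mul_prod_erase _ _ (Finset.mem_univ c), hn, bonacciPoly_succ, add_mul,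
    Polynomial.coeff_add, Nat.cast_add]
  congr 1
  split_ifs with hjn
  · obtain ⟨a, rfl⟩ := Nat.exists_eq_add_of_le' hjn
    rw [setOf_isBanded_top_moved hj hn, (mul_left_injective _).encard_image, Nat.add_sub_cancel,
      mul_assoc]
    cases k with
    | zero => simp
    | succ k =>
      rw [Polynomial.coeff_X_mul, ← hprod, ← ih _ (hsum a (by omega)) _ _ rfl]
      congr 1
      ext π
      simp
  · rw [zero_mul, Polynomial.coeff_zero, Nat.cast_zero, Set.encard_eq_zero]
    ext π
    simp only [Set.mem_ofPred_eq, Set.mem_empty_iff_false, iff_false]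
    rintro ⟨⟨h1, h2⟩, -⟩
    exact hjn (h1.top_block hj hn h2).1

end

/-- The interval `[1, i * m + r]` read in residue classes modulo `m`. -/
lemma mem_Icc_iff_div_mod {m i r : ℕ} (hm : 1 ≤ m) (hr : r ≤ m - 1) (s : ℕ) :
    s ∈ Finset.Icc 1 (i * m + r) ↔
      (if s % m = 0 then 1 else 0) ≤ s / m ∧ s / m < (if s % m = 0 then 1 else 0) +
        (if 1 ≤ s % m ∧ s % m ≤ r then i + 1 else i) := by
  have h1 := Nat.div_add_mod' s m
  have h2 := Nat.mod_lt s hm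
  generalize s / m = q at *
  generalize s % m = c at *
  subst h1
  rw [Finset.mem_Icc]
  rcases lt_trichotomy q i with h | h | h
  · have : (q + 1) * m ≤ i * m := Nat.mul_le_mul_right _ h
    have : q = 0 ∨ 1 * m ≤ q * m := by
      rcases Nat.eq_zero_or_pos q with h | h
      · exact Or.inl h
      · exact Or.inr (Nat.mul_le_mul_right _ h)
    grind
  · subst h
    have : q = 0 ∨ 1 * m ≤ q * m := by
      rcases Nat.eq_zero_or_pos q with h | h
      · exact Or.inl h
      · exact Or.inr (Nat.mul_le_mul_right _ h)
    grind
  · have : (i + 1) * m ≤ q * m := Nat.mul_le_mul_right _ h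
    grind

lemma sub_eq_iff_div_mod {m j : ℕ} (hm : 1 ≤ m) (s t : ℕ) :
    ((t : ℤ) - s = -(m : ℤ) ∨ (t : ℤ) - s = 0 ∨ (t : ℤ) - s = (j : ℤ) * m) ↔
      t % m = s % m ∧ (t / m + 1 = s / m ∨ t / m = s / m ∨ t / m = s / m + j) := by
  constructor
  · rintro (h | h | h)
    · obtain rfl : s = t + m := by omega
      simp [Nat.add_div_right _ hm]
    · obtain rfl : t = s := by omega
      simp
    · obtain rfl : t = s + j * m := by
        zify
        linarith
      simp [Nat.add_mul_div_right _ _ hm]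
  · rintro ⟨h1, h2⟩
    have h3 := Nat.div_add_mod' s m
    have h4 := Nat.div_add_mod' t m
    rcases h2 with h2 | h2 | h2
    · left
      rw [← h3, ← h4, ← h2, h1]
      push_cast
      ring
    · right; left
      rw [← h3, ← h4, h2, h1]
      simp
    · right; right
      rw [← h3, ← h4, h2, h1]
      push_cast
      ring

lemma lt_iff_div_lt_div {m s t : ℕ} (h : t % m = s % m) : s < t ↔ s / m < t / m := by
  have h3 := Nat.div_add_mod' s m
  have h4 := Nat.div_add_mod' t m
  constructor
  · intro h5
    by_contra! h6
    have := Nat.mul_le_mul_right m h6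
    omega
  · intro h5
    by_contra! h6
    exact absurd (Nat.div_le_div_right (c := m) h6) (by omega)

lemma prod_fin_ite_eq_pow {M : Type*} [CommMonoid M] {m r : ℕ} (hm : 1 ≤ m) (hr : r ≤ m - 1)
    (g : ℕ → M) (i : ℕ) :
    ∏ c : Fin m, g (if 1 ≤ (c : ℕ) ∧ (c : ℕ) ≤ r then i + 1 else i) =
      g i ^ (m - r) * g (i + 1) ^ r := by
  obtain ⟨d, rfl⟩ : ∃ d, m = 1 + r + d := ⟨m - r - 1, by omega⟩
  rw [Fin.prod_univ_eq_prod_range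
    (fun c => g (if 1 ≤ c ∧ c ≤ r then i + 1 else i)), Finset.prod_range_add,
    Finset.prod_range_add, Finset.prod_congr rfl (g := fun _ => g (i + 1)) (s₁ := Finset.range r),
    Finset.prod_congr rfl (g := fun _ => g i) (s₁ := Finset.range d)]
  · simp only [Finset.prod_const, Finset.card_range, Finset.prod_range_one]
    rw [show 1 + r + d - r = 1 + d by omega, pow_add, pow_one, mul_right_comm]
    simp
  · intro x hx
    rw [if_neg (by omega)]
  · intro x hx
    rw [Finset.mem_range] at hx
    rw [if_pos (by omega)]

/-- The bijection `s ↦ (s % m, s / m)`. -/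
def modDivEquiv (m : ℕ) [NeZero m] : ℕ ≃ Fin m × ℕ := (Nat.divModEquiv m).trans (prodComm _ _)

/-- the number of permutations `π` of `{1,…,im+r}` with
`π(s)-s ∈ {-m,0,jm}` having exactly `k` excedances equals the coefficient of
`x^k` in `(f^{(j+1)}_i(x))^{m-r} (f^{(j+1)}_{i+1}(x))^r`. -/
theorem stmt_9 (m j i r k : ℕ) (hm : 1 ≤ m) (hj : 1 ≤ j) (hr : r ≤ m - 1) :
    Nat.card {π : Equiv.Perm ℕ //
        (∀ x : ℕ, x ∉ Finset.Icc 1 (i * m + r) → π x = x) ∧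
        (∀ s ∈ Finset.Icc 1 (i * m + r),
          (π s : ℤ) - s = -(m : ℤ) ∨ (π s : ℤ) - s = 0 ∨ (π s : ℤ) - s = (j : ℤ) * m) ∧
        ((Finset.Icc 1 (i * m + r)).filter fun s => s < π s).card = k} =
      (bonacciPoly (j + 1) i ^ (m - r) * bonacciPoly (j + 1) (i + 1) ^ r).coeff k := by
  have : NeZero m := ⟨by omega⟩
  have he1 : ∀ s, ((modDivEquiv m s).1 : ℕ) = s % m := fun s => by simp [modDivEquiv]
  have he2 : ∀ s, (modDivEquiv m s).2 = s / m := fun s => by simp [modDivEquiv]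
  let b : Fin m → ℕ := fun c => if (c : ℕ) = 0 then 1 else 0
  let ℓ : Fin m → ℕ := fun c => if 1 ≤ (c : ℕ) ∧ (c : ℕ) ≤ r then i + 1 else i
  rw [← prod_fin_ite_eq_pow hm hr, ← ENat.natCast_inj, ← encard_isBanded hj b ℓ k]
  have hsupp : ∀ s, s ∈ Finset.Icc 1 (i * m + r) ↔ b (modDivEquiv m s).1 ≤ (modDivEquiv m s).2 ∧
      (modDivEquiv m s).2 < b (modDivEquiv m s).1 + ℓ (modDivEquiv m s).1 := by
    intro s
    simp only [b, ℓ, he1, he2]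
    exact mem_Icc_iff_div_mod hm hr s
  have hband : ∀ π : Perm ℕ, IsBanded j b ℓ ((modDivEquiv m).permCongr π) ↔
      (∀ x : ℕ, x ∉ Finset.Icc 1 (i * m + r) → π x = x) ∧
        (∀ s ∈ Finset.Icc 1 (i * m + r),
          (π s : ℤ) - s = -(m : ℤ) ∨ (π s : ℤ) - s = 0 ∨ (π s : ℤ) - s = (j : ℤ) * m) := by
    intro π
    simp only [IsBanded, (modDivEquiv m).surjective.forall, ← hsupp, permCongr_apply,
      symm_apply_apply, EmbeddingLike.apply_eq_iff_eq]
    simp only [Fin.ext_iff, he1, he2, ← sub_eq_iff_div_mod hm]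
    refine and_congr_right fun h1 => ⟨fun h s _ => h s, fun h s => ?_⟩
    by_cases hs : s ∈ Finset.Icc 1 (i * m + r)
    · exact h s hs
    · simp [h1 s hs]
  have hexc : ∀ π : Perm ℕ, IsBanded j b ℓ ((modDivEquiv m).permCongr π) →
      (excSet ((modDivEquiv m).permCongr π)).encard =
        (((Finset.Icc 1 (i * m + r)).filter fun s => s < π s).card : ℕ) := by
    intro π h
    rw [← Set.encard_coe_eq_coe_finsetCard, ← (modDivEquiv m).injective.encard_image]
    congr 1
    ext x
    obtain ⟨s, rfl⟩ := (modDivEquiv m).surjective x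
    have h1 : π s % m = s % m := by
      simpa [Fin.ext_iff, he1] using (h.2 (modDivEquiv m s)).1
    have h2 := ((hband π).1 h).1 s
    simp only [excSet, Set.mem_ofPred_eq, permCongr_apply, symm_apply_apply, he2,
      ← lt_iff_div_lt_div h1, (modDivEquiv m).injective.mem_set_image, Finset.mem_coe,
      Finset.mem_filter]
    refine ⟨fun h3 => ⟨?_, h3⟩, fun h3 => h3.2⟩
    by_contra h4
    exact h3.ne' (h2 h4)
  have hcard : Nat.card {π : Perm ℕ //
        (∀ x : ℕ, x ∉ Finset.Icc 1 (i * m + r) → π x = x) ∧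
        (∀ s ∈ Finset.Icc 1 (i * m + r),
          (π s : ℤ) - s = -(m : ℤ) ∨ (π s : ℤ) - s = 0 ∨ (π s : ℤ) - s = (j : ℤ) * m) ∧
        ((Finset.Icc 1 (i * m + r)).filter fun s => s < π s).card = k} =
      Set.ncard {π | IsBanded j b ℓ π ∧ (excSet π).encard = k} := by
    refine Nat.card_congr ((modDivEquiv m).permCongr.subtypeEquiv fun π => ?_)
    rw [← and_assoc, ← hband]
    refine and_congr_right fun h => ?_
    rw [hexc π h, ENat.natCast_inj]
  rw [hcard, Set.Finite.cast_ncard_eq]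
  refine Set.finite_of_encard_eq_coe (encard_isBanded hj b ℓ k)
end
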